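/- Let d ≥ 1 be an integer, β ∈ (0, min(d,2)), T > 0, let σ, b : ℝ → ℝ be Lipschitz continuous, let w : [0,T]×ℝ^d → ℝ be bounded and continuous, and fix an admissible h. Then there exists a constant C (depending on d, β, T, σ, b, w and h) such that for every admissible h₀ with H(h₀) ≤ 1, sup_{(t,x)∈[0,T]×ℝ^d} |Φ^{h+h₀}(t,x) − Φ^h(t,x)| ≤ C · H(h₀). In particular, the map h ↦ Φ^h(t,x) is continuous at each admissible h for every fixed (t,x). -/

import Mathlib

open MeasureTheory Real Set

noncomputable section

/-- Euclidean space `ℝ^d`. -/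
abbrev Ed (d : ℕ) := EuclideanSpace ℝ (Fin d)

/-- The heat kernel `Λ(t,x) = (4πt)^{−d/2} exp(−|x|²/(4t))` on `ℝ^d`. -/
def heatKernel (d : ℕ) (t : ℝ) (x : Ed d) : ℝ :=
  (4 * π * t) ^ (-(d : ℝ) / 2) * Real.exp (-‖x‖ ^ 2 / (4 * t))

/-- A measurable function `g : [0,T]×ℝ^d → ℝ` is admissible if
`∫₀ᵀ ∫∫ |g(s,y)| |g(s,y′)| |y−y′|^{−β} dy dy′ ds < ∞`. -/
def Admissible (d : ℕ) (β T : ℝ) (g : ℝ → Ed d → ℝ) : Prop :=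
  Measurable (fun p : ℝ × Ed d => g p.1 p.2) ∧
  (∫⁻ s in Ioc (0 : ℝ) T, ∫⁻ y : Ed d, ∫⁻ y' : Ed d,
    ENNReal.ofReal (|g s y| * |g s y'| * ‖y - y'‖ ^ (-β))) < ⊤

/-- `Φ` is a bounded measurable solution on `[0,T]×ℝ^d` of the skeleton equation
`Φ(t,x) = w(t,x) + ∫₀ᵗ ∫∫ Λ(t−s,x−y) σ(Φ(s,y)) |y−y′|^{−β} h(s,y′) dy′ dy ds
          + ∫₀ᵗ ∫ Λ(t−s,x−y) b(Φ(s,y)) dy ds`,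
all integrals being absolutely convergent. -/
structure IsSkeletonSolution (d : ℕ) (β T : ℝ) (σ b : ℝ → ℝ)
    (w : ℝ → Ed d → ℝ) (h : ℝ → Ed d → ℝ) (Φ : ℝ → Ed d → ℝ) : Prop where
  measurable : Measurable (fun p : ℝ × Ed d => Φ p.1 p.2)
  bounded : ∃ M : ℝ, ∀ t ∈ Icc (0 : ℝ) T, ∀ x : Ed d, |Φ t x| ≤ M
  abs_conv_noise : ∀ t ∈ Icc (0 : ℝ) T, ∀ x : Ed d,
    (∫⁻ s in Ioc (0 : ℝ) t, ∫⁻ y : Ed d, ∫⁻ y' : Ed d,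
      ENNReal.ofReal
        (|heatKernel d (t - s) (x - y) * σ (Φ s y) * ‖y - y'‖ ^ (-β) * h s y'|)) < ⊤
  abs_conv_drift : ∀ t ∈ Icc (0 : ℝ) T, ∀ x : Ed d,
    (∫⁻ s in Ioc (0 : ℝ) t, ∫⁻ y : Ed d,
      ENNReal.ofReal (|heatKernel d (t - s) (x - y) * b (Φ s y)|)) < ⊤
  eqn : ∀ t ∈ Icc (0 : ℝ) T, ∀ x : Ed d,
    Φ t x = w t x
      + (∫ s in Ioc (0 : ℝ) t, ∫ y : Ed d, ∫ y' : Ed d,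
          heatKernel d (t - s) (x - y) * σ (Φ s y) * ‖y - y'‖ ^ (-β) * h s y')
      + ∫ s in Ioc (0 : ℝ) t, ∫ y : Ed d, heatKernel d (t - s) (x - y) * b (Φ s y)


/-- The `𝓗_T`-norm of an admissible function:
`H(g) := sqrt( ∫₀ᵀ ∫∫ g(s,y) g(s,y′) |y−y′|^{−β} dy dy′ ds )`. -/
def Hnorm (d : ℕ) (β T : ℝ) (g : ℝ → Ed d → ℝ) : ℝ :=
  Real.sqrt (∫ s in Ioc (0 : ℝ) T, ∫ y : Ed d, ∫ y' : Ed d,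
    g s y * g s y' * ‖y - y'‖ ^ (-β))

open scoped ENNReal

lemma sk_gauss (d : ℕ) {b : ℝ} (hb : 0 < b) (m : Ed d) :
    ∫⁻ z : Ed d, ENNReal.ofReal (Real.exp (-b * ‖z - m‖ ^ 2))
      = ENNReal.ofReal ((π / b) ^ ((d : ℝ) / 2)) := by
  have h1 := GaussianFourier.integral_rexp_neg_mul_sq_norm (V := Ed d) hb
  have hi : Integrable (fun v : Ed d => Real.exp (-b * ‖v‖ ^ 2)) :=
    .of_integral_ne_zero (by rw [h1]; positivity)
  rw [lintegral_sub_right_eq_self (μ := (volume : Measure (Ed d)))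
    (fun z => ENNReal.ofReal (Real.exp (-b * ‖z‖ ^ 2))) m]
  rw [← ofReal_integral_eq_lintegral_ofReal hi (ae_of_all _ fun _ => (Real.exp_pos _).le), h1]
  simp

lemma sk_gamma {a r : ℝ} (ha : 0 < a) (hr : 0 < r) :
    ∫⁻ t : ℝ in Ioi 0, ENNReal.ofReal (t ^ (a - 1) * Real.exp (-(r * t)))
      = ENNReal.ofReal ((1 / r) ^ a * Real.Gamma a) := by
  have h1 := Real.integral_rpow_mul_exp_neg_mul_Ioi ha hr
  have := Real.Gamma_pos_of_pos ha
  rw [← h1, ofReal_integral_eq_lintegral_ofReal]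
  · exact .of_integral_ne_zero (by rw [h1]; positivity)
  · refine (ae_restrict_iff' measurableSet_Ioi).2 (ae_of_all _ fun t (ht : 0 < t) => ?_)
    simp only [Pi.zero_apply]
    positivity

/-- weight -/
def skC (d : ℕ) (β r : ℝ) : ℝ := r ^ (β / 2 - 1) / Real.Gamma (β / 2) * (4 * r / π) ^ ((d : ℝ) / 2)

/-- square root kernel -/
def skK (d : ℕ) (β : ℝ) (ω : ℝ × Ed d) (y : Ed d) : ℝ≥0∞ :=
  (Ioi (0 : ℝ)).indicator (fun r => ENNReal.ofReal (√(skC d β r))) ω.1 *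
    ENNReal.ofReal (Real.exp (-(2 * ω.1) * ‖y - ω.2‖ ^ 2))

lemma skK_meas (d : ℕ) (β : ℝ) : Measurable (fun p : (ℝ × Ed d) × Ed d => skK d β p.1 p.2) := by
  unfold skK
  refine Measurable.mul ?_ (by fun_prop)
  refine (Measurable.indicator ?_ measurableSet_Ioi).comp (measurable_fst.comp measurable_fst)
  unfold skC
  fun_prop

lemma sk_para (d : ℕ) (y y' z : Ed d) (r : ℝ) :
    -(2 * r) * ‖y - z‖ ^ 2 + -(2 * r) * ‖y' - z‖ ^ 2
      = -(r * ‖y - y'‖ ^ 2) + -(4 * r) * ‖z - (2⁻¹ : ℝ) • (y + y')‖ ^ 2 := by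
  have h := parallelogram_law_with_norm ℝ (y - z) (y' - z)
  have e1 : y - z + (y' - z) = (-2 : ℝ) • (z - (2⁻¹ : ℝ) • (y + y')) := by
    module
  have e2 : y - z - (y' - z) = y - y' := by abel
  rw [e1, e2, norm_smul] at h
  have e3 : ‖(-2 : ℝ)‖ = 2 := by norm_num
  rw [e3] at h
  linear_combination (r) * h

lemma skK_rep (d : ℕ) {β : ℝ} (hβ : 0 < β) {y y' : Ed d} (hy : y ≠ y') :
    ENNReal.ofReal (‖y - y'‖ ^ (-β)) = ∫⁻ ω, skK d β ω y * skK d β ω y' := by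
  have hm : Measurable (fun ω => skK d β ω y * skK d β ω y') :=
    ((skK_meas d β).comp (measurable_id.prodMk measurable_const)).mul
      ((skK_meas d β).comp (measurable_id.prodMk measurable_const))
  have hn : 0 < ‖y - y'‖ := norm_pos_iff.2 (sub_ne_zero.2 hy)
  have hG := Real.Gamma_pos_of_pos (half_pos hβ)
  rw [Measure.volume_eq_prod, lintegral_prod _ hm.aemeasurable]
  have key : ∀ r : ℝ, ∫⁻ z, skK d β (r, z) y * skK d β (r, z) y' =
      (Ioi (0 : ℝ)).indicator (fun r => ENNReal.ofReal ((Real.Gamma (β / 2))⁻¹) *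
        ENNReal.ofReal (r ^ (β / 2 - 1) * Real.exp (-(‖y - y'‖ ^ 2 * r)))) r := by
    intro r
    by_cases hr : r ∈ Ioi (0 : ℝ)
    · have hr0 : 0 < r := hr
      have hc : 0 ≤ skC d β r := by unfold skC; positivity
      simp only [skK, indicator_of_mem hr]
      have : ∀ z, ENNReal.ofReal (√(skC d β r)) * ENNReal.ofReal (Real.exp (-(2 * r) * ‖y - z‖ ^ 2)) *
          (ENNReal.ofReal (√(skC d β r)) * ENNReal.ofReal (Real.exp (-(2 * r) * ‖y' - z‖ ^ 2)))
          = ENNReal.ofReal (skC d β r * Real.exp (-(r * ‖y - y'‖ ^ 2))) *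
            ENNReal.ofReal (Real.exp (-(4 * r) * ‖z - (2⁻¹ : ℝ) • (y + y')‖ ^ 2)) := by
        intro z
        rw [← ENNReal.ofReal_mul (by positivity), ← ENNReal.ofReal_mul (by positivity),
          ← ENNReal.ofReal_mul (by positivity), ← ENNReal.ofReal_mul (by positivity)]
        congr 1
        rw [mul_mul_mul_comm, Real.mul_self_sqrt hc, ← Real.exp_add, sk_para, Real.exp_add]
        ring
      simp_rw [this]
      rw [lintegral_const_mul _ (by fun_prop), sk_gauss d (by positivity),
        ← ENNReal.ofReal_mul (by positivity), ← ENNReal.ofReal_mul (by positivity)]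
      congr 1
      have h1 : (4 * r / π) ^ ((d : ℝ) / 2) * (π / (4 * r)) ^ ((d : ℝ) / 2) = 1 := by
        rw [← Real.mul_rpow (by positivity) (by positivity)]
        have : 4 * r / π * (π / (4 * r)) = 1 := by field_simp
        rw [this, Real.one_rpow]
      unfold skC
      rw [mul_comm r]
      linear_combination (r ^ (β / 2 - 1) / Real.Gamma (β / 2) *
        Real.exp (-(‖y - y'‖ ^ 2 * r))) * h1
    · simp [skK, indicator_of_notMem hr]
  simp_rw [key]
  rw [lintegral_indicator measurableSet_Ioi, lintegral_const_mul _ (by fun_prop),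
    sk_gamma (half_pos hβ) (by positivity), ← ENNReal.ofReal_mul (by positivity)]
  congr 1
  rw [one_div, ← Real.rpow_natCast, ← Real.rpow_neg hn.le, ← Real.rpow_mul hn.le]
  have : -((2 : ℕ) : ℝ) * (β / 2) = -β := by push_cast; ring
  rw [this]
  field_simp

/-- spatial form -/
def skI (d : ℕ) (β : ℝ) (u v : Ed d → ℝ≥0∞) : ℝ≥0∞ :=
  ∫⁻ y, ∫⁻ y', u y * v y' * ENNReal.ofReal (‖y - y'‖ ^ (-β))

lemma skI_eq (d : ℕ) (hd : 1 ≤ d) {β : ℝ} (hβ : 0 < β) {u v : Ed d → ℝ≥0∞} (hu : Measurable u)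
    (hv : Measurable v) :
    skI d β u v = ∫⁻ ω, (∫⁻ y, u y * skK d β ω y) * (∫⁻ y, v y * skK d β ω y) := by
  have : Nonempty (Fin d) := ⟨⟨0, hd⟩⟩
  have : Nontrivial (Ed d) := inferInstance
  have hK := skK_meas d β
  have h1 : ∀ y, ∫⁻ y', u y * v y' * ENNReal.ofReal (‖y - y'‖ ^ (-β)) =
      ∫⁻ ω, u y * skK d β ω y * (∫⁻ y', v y' * skK d β ω y') := by
    intro y
    have : ∫⁻ y', u y * v y' * ENNReal.ofReal (‖y - y'‖ ^ (-β)) =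
        ∫⁻ y', ∫⁻ ω, (u y * skK d β ω y) * (v y' * skK d β ω y') := by
      apply lintegral_congr_ae
      filter_upwards [(measure_eq_zero_iff_ae_notMem.1 (measure_singleton (μ := volume) y))] with y' hy'
      have hne : y ≠ y' := fun h => hy' (by simp [h])
      rw [skK_rep d hβ hne, ← lintegral_const_mul]
      · congr 1; ext ω; ring
      · exact ((hK).comp (measurable_id.prodMk measurable_const)).mul
          ((hK).comp (measurable_id.prodMk measurable_const))
    rw [this, lintegral_lintegral_swap]
    · congr 1; ext ω
      rw [lintegral_const_mul]
      exact hv.mul (hK.comp (measurable_const.prodMk measurable_id))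
    · apply Measurable.aemeasurable
      refine Measurable.mul (measurable_const.mul (hK.comp (measurable_snd.prodMk measurable_const)))
        ((hv.comp measurable_fst).mul (hK.comp (measurable_snd.prodMk measurable_fst)))
  unfold skI
  simp_rw [h1]
  have hV : Measurable (fun ω => ∫⁻ y', v y' * skK d β ω y') := by
    refine Measurable.lintegral_prod_right' (f := fun p : (ℝ × Ed d) × Ed d => v p.2 * skK d β p.1 p.2) ?_
    exact (hv.comp measurable_snd).mul hK
  rw [lintegral_lintegral_swap]
  · congr 1; ext ω
    rw [lintegral_mul_const]
    exact hu.mul (hK.comp (measurable_const.prodMk measurable_id))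
  · apply Measurable.aemeasurable
    exact ((hu.comp measurable_fst).mul (hK.comp (measurable_snd.prodMk measurable_fst))).mul
      (hV.comp measurable_snd)

lemma sk_amgm (a b : ℝ≥0∞) : 2 * (a * b) ≤ a * a + b * b := by
  rcases eq_or_ne a ⊤ with rfl | ha
  · simp
  rcases eq_or_ne b ⊤ with rfl | hb
  · simp
  lift a to NNReal using ha
  lift b to NNReal using hb
  norm_cast
  have := two_mul_le_add_sq a b
  nlinarith

lemma skI_amgm (d : ℕ) (hd : 1 ≤ d) {β : ℝ} (hβ : 0 < β) {u v : Ed d → ℝ≥0∞} (hu : Measurable u)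
    (hv : Measurable v) : 2 * skI d β u v ≤ skI d β u u + skI d β v v := by
  have hK := skK_meas d β
  have hm : ∀ {v : Ed d → ℝ≥0∞}, Measurable v → Measurable (fun ω => ∫⁻ y', v y' * skK d β ω y') := by
    intro v hv
    refine Measurable.lintegral_prod_right' (f := fun p : (ℝ × Ed d) × Ed d => v p.2 * skK d β p.1 p.2) ?_
    exact (hv.comp measurable_snd).mul hK
  rw [skI_eq d hd hβ hu hv, skI_eq d hd hβ hu hu, skI_eq d hd hβ hv hv,
    ← lintegral_const_mul' 2 _ (by simp)]
  refine (lintegral_mono fun ω => sk_amgm _ _).trans_eq ?_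
  exact lintegral_add_left ((hm hu).mul (hm hu)) _

/-- space-time measure -/
def skP (d : ℕ) (T : ℝ) : Measure (ℝ × (Ed d × Ed d)) :=
  (volume.restrict (Ioc 0 T)).prod (volume.prod volume)

instance skP_sf (d : ℕ) (T : ℝ) : SFinite (skP d T) := by unfold skP; infer_instance

/-- integrand -/
def skq (d : ℕ) (β : ℝ) (f g : ℝ → Ed d → ℝ) (p : ℝ × (Ed d × Ed d)) : ℝ :=
  f p.1 p.2.1 * g p.1 p.2.2 * ‖p.2.1 - p.2.2‖ ^ (-β)

/-- joint measurability -/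
def skM {d : ℕ} (f : ℝ → Ed d → ℝ) : Prop := Measurable (fun p : ℝ × Ed d => f p.1 p.2)

lemma skM.l {d : ℕ} {f : ℝ → Ed d → ℝ} (hf : skM f) :
    Measurable (fun p : ℝ × (Ed d × Ed d) => f p.1 p.2.1) :=
  Measurable.comp (g := fun p : ℝ × Ed d => f p.1 p.2) hf
    (measurable_fst.prodMk (measurable_fst.comp measurable_snd))

lemma skM.r {d : ℕ} {f : ℝ → Ed d → ℝ} (hf : skM f) :
    Measurable (fun p : ℝ × (Ed d × Ed d) => f p.1 p.2.2) :=
  Measurable.comp (g := fun p : ℝ × Ed d => f p.1 p.2) hf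
    (measurable_fst.prodMk (measurable_snd.comp measurable_snd))

lemma skM.s {d : ℕ} {f : ℝ → Ed d → ℝ} (hf : skM f) (s : ℝ) : Measurable (f s) :=
  Measurable.comp (g := fun p : ℝ × Ed d => f p.1 p.2) hf (measurable_const.prodMk measurable_id)

lemma skq_meas {d : ℕ} (β : ℝ) {f g : ℝ → Ed d → ℝ} (hf : skM f) (hg : skM g) :
    Measurable (skq d β f g) := by
  unfold skq
  exact (hf.l.mul hg.r).mul (by fun_prop)

lemma skq_lint {d : ℕ} (β T : ℝ) {f g : ℝ → Ed d → ℝ} (hf : skM f) (hg : skM g) :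
    ∫⁻ p, ‖skq d β f g p‖ₑ ∂(skP d T) =
      ∫⁻ s in Ioc 0 T, skI d β (fun y => ‖f s y‖ₑ) (fun y => ‖g s y‖ₑ) := by
  unfold skP
  rw [lintegral_prod _ (skq_meas β hf hg).enorm.aemeasurable]
  congr 1; ext s
  rw [lintegral_prod]
  · unfold skI
    congr 1; ext y; congr 1; ext y'
    simp only [skq, enorm_mul]
    congr 1
    rw [Real.enorm_eq_ofReal (by positivity)]
  · exact (((skq_meas β hf hg).comp (measurable_const.prodMk measurable_id)).enorm).aemeasurable

lemma skI_meas {d : ℕ} (β : ℝ) {f g : ℝ → Ed d → ℝ} (hf : skM f) (hg : skM g) :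
    Measurable (fun s => skI d β (fun y => ‖f s y‖ₑ) (fun y => ‖g s y‖ₑ)) := by
  unfold skI
  refine Measurable.lintegral_prod_right' (f := fun p : ℝ × Ed d =>
    ∫⁻ y', ‖f p.1 p.2‖ₑ * ‖g p.1 y'‖ₑ * ENNReal.ofReal (‖p.2 - y'‖ ^ (-β))) ?_
  refine Measurable.lintegral_prod_right' (f := fun p : (ℝ × Ed d) × Ed d =>
    ‖f p.1.1 p.1.2‖ₑ * ‖g p.1.1 p.2‖ₑ * ENNReal.ofReal (‖p.1.2 - p.2‖ ^ (-β))) ?_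
  have a1 : Measurable (fun p : (ℝ × Ed d) × Ed d => ‖f p.1.1 p.1.2‖ₑ) :=
    (Measurable.comp (g := fun p : ℝ × Ed d => f p.1 p.2) hf measurable_fst).enorm
  have a2 : Measurable (fun p : (ℝ × Ed d) × Ed d => ‖g p.1.1 p.2‖ₑ) :=
    (Measurable.comp (g := fun p : ℝ × Ed d => g p.1 p.2) hg
      ((measurable_fst.comp measurable_fst).prodMk measurable_snd)).enorm
  exact (a1.mul a2).mul (by fun_prop)

lemma skq_amgm {d : ℕ} (hd : 1 ≤ d) {β : ℝ} (hβ : 0 < β) (T : ℝ) {f g : ℝ → Ed d → ℝ}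
    (hf : skM f) (hg : skM g) :
    2 * ∫⁻ p, ‖skq d β f g p‖ₑ ∂(skP d T) ≤
      ∫⁻ p, ‖skq d β f f p‖ₑ ∂(skP d T) + ∫⁻ p, ‖skq d β g g p‖ₑ ∂(skP d T) := by
  rw [skq_lint β T hf hg, skq_lint β T hf hf, skq_lint β T hg hg,
    ← lintegral_const_mul' 2 _ (by simp), ← lintegral_add_left (skI_meas β hf hf)]
  exact lintegral_mono fun s => skI_amgm d hd hβ (hf.s s).enorm (hg.s s).enorm

lemma skq_int {d : ℕ} (hd : 1 ≤ d) {β : ℝ} (hβ : 0 < β) {T : ℝ} {f g : ℝ → Ed d → ℝ}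
    (hf : skM f) (hg : skM g) (hff : Integrable (skq d β f f) (skP d T))
    (hgg : Integrable (skq d β g g) (skP d T)) : Integrable (skq d β f g) (skP d T) := by
  refine ⟨(skq_meas β hf hg).aestronglyMeasurable, ?_⟩
  have h := skq_amgm hd hβ T hf hg
  have h2 := h.trans_lt (ENNReal.add_lt_top.2 ⟨hff.2, hgg.2⟩)
  exact lt_of_le_of_lt (le_mul_of_one_le_left' (by norm_num)) h2

/-- the bilinear form -/
def skB (d : ℕ) (β T : ℝ) (f g : ℝ → Ed d → ℝ) : ℝ := ∫ p, skq d β f g p ∂(skP d T)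

lemma skB_amgm {d : ℕ} (hd : 1 ≤ d) {β : ℝ} (hβ : 0 < β) {T : ℝ} {f g : ℝ → Ed d → ℝ}
    (hf : skM f) (hg : skM g) (hff : Integrable (skq d β f f) (skP d T))
    (hgg : Integrable (skq d β g g) (skP d T)) (hf0 : ∀ s y, 0 ≤ f s y) (hg0 : ∀ s y, 0 ≤ g s y) :
    2 * skB d β T f g ≤ skB d β T f f + skB d β T g g := by
  have key : ∀ {f g : ℝ → Ed d → ℝ}, (∀ s y, 0 ≤ f s y) → (∀ s y, 0 ≤ g s y) → skM f → skM g →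
      skB d β T f g = (∫⁻ p, ‖skq d β f g p‖ₑ ∂(skP d T)).toReal := by
    intro f g hf0 hg0 hf hg
    have h0 : ∀ p, 0 ≤ skq d β f g p := fun p =>
      mul_nonneg (mul_nonneg (hf0 _ _) (hg0 _ _)) (by positivity)
    rw [skB, ← integral_toReal (skq_meas β hf hg).enorm.aemeasurable (ae_of_all _ fun _ => by simp)]
    congr 1; ext p
    rw [toReal_enorm, Real.norm_of_nonneg (h0 p)]
  rw [key hf0 hg0 hf hg, key hf0 hf0 hf hf, key hg0 hg0 hg hg,
    ← ENNReal.toReal_add hff.2.ne hgg.2.ne]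
  have h := ENNReal.toReal_mono (ENNReal.add_ne_top.2 ⟨hff.2.ne, hgg.2.ne⟩) (skq_amgm hd hβ T hf hg)
  simpa using h

lemma skM.pos {d : ℕ} {f : ℝ → Ed d → ℝ} (hf : skM f) : skM (fun s y => max (f s y) 0) :=
  Measurable.max hf measurable_const

lemma skM.neg {d : ℕ} {f : ℝ → Ed d → ℝ} (hf : skM f) : skM (fun s y => -f s y) :=
  Measurable.neg hf

lemma skq_mono {d : ℕ} {β T : ℝ} {f g f' g' : ℝ → Ed d → ℝ}
    (hf : skM f) (hg : skM g) (hff : Integrable (skq d β f' g') (skP d T))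
    (h1 : ∀ s y, |f s y| ≤ |f' s y|) (h2 : ∀ s y, |g s y| ≤ |g' s y|) :
    Integrable (skq d β f g) (skP d T) := by
  refine hff.mono (skq_meas β hf hg).aestronglyMeasurable (ae_of_all _ fun p => ?_)
  simp only [skq, norm_mul, Real.norm_eq_abs]
  rw [abs_of_nonneg (show 0 ≤ ‖p.2.1 - p.2.2‖ ^ (-β) by positivity)]
  exact mul_le_mul_of_nonneg_right
    (mul_le_mul (h1 _ _) (h2 _ _) (abs_nonneg _) (abs_nonneg _)) (by positivity)

lemma skB_nonneg {d : ℕ} (hd : 1 ≤ d) {β : ℝ} (hβ : 0 < β) {T : ℝ} {f : ℝ → Ed d → ℝ}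
    (hf : skM f) (hff : Integrable (skq d β f f) (skP d T)) : 0 ≤ skB d β T f f := by
  set u : ℝ → Ed d → ℝ := fun s y => max (f s y) 0 with hu
  set v : ℝ → Ed d → ℝ := fun s y => max (-f s y) 0 with hv
  have mu : skM u := hf.pos
  have mv : skM v := hf.neg.pos
  have u0 : ∀ s y, 0 ≤ u s y := fun s y => le_max_right _ _
  have v0 : ∀ s y, 0 ≤ v s y := fun s y => le_max_right _ _
  have hul : ∀ s y, |u s y| ≤ |f s y| := fun s y => by
    rw [abs_of_nonneg (u0 s y)]; exact max_le (le_abs_self _) (abs_nonneg _)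
  have hvl : ∀ s y, |v s y| ≤ |f s y| := fun s y => by
    rw [abs_of_nonneg (v0 s y)]; exact max_le (neg_le_abs _) (abs_nonneg _)
  have huv : ∀ s y, f s y = u s y - v s y := fun s y => by
    simp only [hu, hv]
    rcases le_total 0 (f s y) with h | h
    · rw [max_eq_left h, max_eq_right (by linarith)]; ring
    · rw [max_eq_right h, max_eq_left (by linarith)]; ring
  have i1 := skq_mono mu mu hff hul hul
  have i2 := skq_mono mu mv hff hul hvl
  have i3 := skq_mono mv mu hff hvl hul
  have i4 := skq_mono mv mv hff hvl hvl
  have e : skB d β T f f = skB d β T u u - skB d β T u v - (skB d β T v u - skB d β T v v) := by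
    unfold skB
    rw [← integral_sub i1 i2, ← integral_sub i3 i4]
    refine Eq.trans ?_ (integral_sub (i1.sub i2) (i3.sub i4))
    congr 1; ext p
    simp only [skq, huv p.1 p.2.1, huv p.1 p.2.2]
    ring
  have a1 := skB_amgm hd hβ mu mv i1 i4 u0 v0
  have a2 := skB_amgm hd hβ mv mu i4 i1 v0 u0
  linarith

lemma skB_iter {d : ℕ} {β T : ℝ} {f g : ℝ → Ed d → ℝ}
    (hfg : Integrable (skq d β f g) (skP d T)) :
    skB d β T f g = ∫ s in Ioc (0 : ℝ) T, ∫ y, ∫ y', f s y * g s y' * ‖y - y'‖ ^ (-β) := by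
  unfold skB skP
  rw [integral_prod _ hfg]
  apply integral_congr_ae
  filter_upwards [hfg.prod_right_ae] with s hs
  rw [integral_prod _ hs]
  rfl

lemma skB_symm {d : ℕ} {β T : ℝ} {f g : ℝ → Ed d → ℝ}
    (hfg : Integrable (skq d β f g) (skP d T)) (hgf : Integrable (skq d β g f) (skP d T)) :
    skB d β T f g = skB d β T g f := by
  unfold skB skP
  rw [integral_prod _ hfg, integral_prod _ hgf]
  congr 1; ext s
  rw [← integral_prod_swap]
  congr 1; ext p
  simp only [skq, Prod.fst_swap, Prod.snd_swap]
  rw [norm_sub_rev]; ring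

lemma skq_lin {d : ℕ} (hd : 1 ≤ d) {β : ℝ} (hβ : 0 < β) {T : ℝ} {f g : ℝ → Ed d → ℝ}
    (hf : skM f) (hg : skM g) (hff : Integrable (skq d β f f) (skP d T))
    (hgg : Integrable (skq d β g g) (skP d T)) (c : ℝ) :
    skM (fun s y => f s y + c * g s y) ∧
    Integrable (skq d β (fun s y => f s y + c * g s y) (fun s y => f s y + c * g s y)) (skP d T) ∧
    skB d β T (fun s y => f s y + c * g s y) (fun s y => f s y + c * g s y) =
      skB d β T f f + 2 * c * skB d β T f g + c ^ 2 * skB d β T g g := by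
  have i2 := skq_int hd hβ hf hg hff hgg
  have i3 := skq_int hd hβ hg hf hgg hff
  have e : skq d β (fun s y => f s y + c * g s y) (fun s y => f s y + c * g s y) =
      fun p => skq d β f f p + c * skq d β f g p + (c * skq d β g f p + c ^ 2 * skq d β g g p) := by
    ext p; simp only [skq]; ring
  have j1 : Integrable (fun p => skq d β f f p + c * skq d β f g p) (skP d T) :=
    hff.add (i2.const_mul c)
  have j2 : Integrable (fun p => c * skq d β g f p + c ^ 2 * skq d β g g p) (skP d T) :=
    (i3.const_mul c).add (hgg.const_mul _)
  refine ⟨Measurable.add hf (Measurable.const_mul hg c), ?_, ?_⟩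
  · rw [e]; exact j1.add j2
  · rw [skB, e, integral_add j1 j2, integral_add hff (i2.const_mul c),
      integral_add (i3.const_mul c) (hgg.const_mul _), integral_const_mul, integral_const_mul,
      integral_const_mul]
    have := skB_symm i2 i3
    unfold skB at this ⊢
    rw [← this]; ring

lemma skB_cs {d : ℕ} (hd : 1 ≤ d) {β : ℝ} (hβ : 0 < β) {T : ℝ} {f g : ℝ → Ed d → ℝ}
    (hf : skM f) (hg : skM g) (hff : Integrable (skq d β f f) (skP d T))
    (hgg : Integrable (skq d β g g) (skP d T)) :
    skB d β T f g ^ 2 ≤ skB d β T f f * skB d β T g g := by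
  have h := discrim_le_zero (a := skB d β T g g) (b := 2 * skB d β T f g) (c := skB d β T f f)
    (fun c => by
      obtain ⟨h1, h2, h3⟩ := skq_lin hd hβ hf hg hff hgg c
      have := skB_nonneg hd hβ h1 h2
      rw [h3] at this
      linarith)
  unfold discrim at h
  nlinarith

lemma sk_adm {d : ℕ} {β T : ℝ} {g : ℝ → Ed d → ℝ} (hg : Admissible d β T g) :
    skM g ∧ Integrable (skq d β g g) (skP d T) ∧ 0 ≤ Hnorm d β T g ∧
      (0 ≤ skB d β T g g → Hnorm d β T g ^ 2 = skB d β T g g) := by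
  obtain ⟨hm, hi⟩ := hg
  have hm' : skM g := hm
  have hint : Integrable (skq d β g g) (skP d T) := by
    refine ⟨(skq_meas β hm' hm').aestronglyMeasurable, ?_⟩
    rw [hasFiniteIntegral_iff_enorm, skq_lint β T hm' hm']
    convert hi using 4 with s
    unfold skI
    congr 1; ext y; congr 1; ext y'
    rw [ENNReal.ofReal_mul (by positivity), ENNReal.ofReal_mul (by positivity),
      ← Real.norm_eq_abs, ← Real.norm_eq_abs, ofReal_norm, ofReal_norm]
  refine ⟨hm', hint, Real.sqrt_nonneg _, fun h => ?_⟩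
  rw [Hnorm, ← skB_iter hint, Real.sq_sqrt h]

lemma sk_hk_nonneg (d : ℕ) {r : ℝ} (hr : 0 ≤ r) (x : Ed d) : 0 ≤ heatKernel d r x := by
  unfold heatKernel; positivity

lemma sk_hk_zero {d : ℕ} (hd : 1 ≤ d) (x : Ed d) : heatKernel d 0 x = 0 := by
  unfold heatKernel
  have : (d : ℝ) ≠ 0 := by positivity
  rw [mul_zero, Real.zero_rpow (by simpa [neg_div] using this), zero_mul]

lemma sk_hk_meas (d : ℕ) : Measurable (fun p : ℝ × Ed d => heatKernel d p.1 p.2) := by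
  unfold heatKernel; fun_prop

lemma sk_hk_meas' (d : ℕ) (t : ℝ) (x : Ed d) : skM (fun s y => heatKernel d (t - s) (x - y)) := by
  unfold skM heatKernel; fun_prop

lemma sk_hk_int (d : ℕ) {r : ℝ} (hr : 0 < r) (x : Ed d) :
    ∫⁻ y, ENNReal.ofReal (heatKernel d r (x - y)) = 1 := by
  rw [lintegral_sub_left_eq_self (μ := (volume : Measure (Ed d)))
    (fun y => ENNReal.ofReal (heatKernel d r y)) x]
  have h := sk_gauss d (b := 1 / (4 * r)) (by positivity) 0
  unfold heatKernel
  simp_rw [ENNReal.ofReal_mul (show 0 ≤ (4 * π * r) ^ (-(d : ℝ) / 2) by positivity)]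
  rw [lintegral_const_mul _ (by fun_prop)]
  have e : ∀ y : Ed d, -‖y‖ ^ 2 / (4 * r) = -(1 / (4 * r)) * ‖y - 0‖ ^ 2 := by
    intro y; rw [sub_zero]; ring
  simp_rw [e]
  rw [h, ← ENNReal.ofReal_mul (by positivity)]
  have e2 : π / (1 / (4 * r)) = 4 * π * r := by field_simp
  rw [e2, ← Real.rpow_add (by positivity)]
  have : -(d : ℝ) / 2 + (d : ℝ) / 2 = 0 := by ring
  simp [this]

lemma sk_loc {d : ℕ} (hd : 1 ≤ d) {β : ℝ} (hβ : β < d) :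
    ∃ c : ℝ, 0 ≤ c ∧ ∀ R : ℝ, 0 < R → ∫⁻ z in Metric.ball (0 : Ed d) R, ENNReal.ofReal (‖z‖ ^ (-β))
      = ENNReal.ofReal (c * R ^ ((d : ℝ) - β)) := by
  have : Nonempty (Fin d) := ⟨⟨0, hd⟩⟩
  have : Nontrivial (Ed d) := inferInstance
  have hint : ∀ R : ℝ, 0 < R →
      IntegrableOn (fun z : Ed d => ‖z‖ ^ (-β)) (Metric.ball (0 : Ed d) R) := by
    intro R hR
    rw [integrableOn_fun_norm_addHaar (μ := volume) (f := fun y : ℝ => y ^ (-β))]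
    have h1 : IntegrableOn (fun y : ℝ => y ^ ((d : ℝ) - 1 - β)) (Ioo 0 R) :=
      (intervalIntegral.integrableOn_Ioo_rpow_iff hR).2 (by linarith)
    refine h1.congr_fun (fun y hy => ?_) measurableSet_Ioo
    simp only [finrank_euclideanSpace, Fintype.card_fin, smul_eq_mul]
    rw [← Real.rpow_natCast, ← Real.rpow_add hy.1]
    push_cast [Nat.cast_sub hd]
    ring_nf
  refine ⟨∫ z in Metric.ball (0 : Ed d) 1, ‖z‖ ^ (-β),
    setIntegral_nonneg measurableSet_ball fun z _ => by positivity, fun R hR => ?_⟩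
  rw [← ofReal_integral_eq_lintegral_ofReal (hint R hR) (ae_of_all _ fun _ => by positivity)]
  congr 1
  have h := Measure.setIntegral_comp_smul_of_pos (volume : Measure (Ed d))
    (fun z => ‖z‖ ^ (-β)) (Metric.ball 0 1) hR
  rw [smul_unitBall_of_pos hR] at h
  simp only [norm_smul, Real.norm_eq_abs, abs_of_pos hR, finrank_euclideanSpace, Fintype.card_fin,
    smul_eq_mul] at h
  simp_rw [Real.mul_rpow hR.le (norm_nonneg _)] at h
  rw [integral_const_mul] at h
  have h2 : R ^ d * (R ^ d)⁻¹ = 1 := mul_inv_cancel₀ (by positivity)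
  rw [sub_eq_add_neg, Real.rpow_add hR, Real.rpow_natCast]
  linear_combination (-R ^ d) * h - (∫ z in Metric.ball (0 : Ed d) R, ‖z‖ ^ (-β)) * h2

lemma sk_hk_riesz {d : ℕ} (hd : 1 ≤ d) {β : ℝ} (hβ0 : 0 < β) (hβ : β < d) :
    ∃ c : ℝ, 0 ≤ c ∧ ∀ r : ℝ, 0 < r → ∀ x y : Ed d,
      ∫⁻ y', ENNReal.ofReal (heatKernel d r (x - y')) * ENNReal.ofReal (‖y - y'‖ ^ (-β))
        ≤ ENNReal.ofReal (c * r ^ (-β / 2)) := by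
  obtain ⟨c, hc, h⟩ := sk_loc hd hβ
  refine ⟨(4 * π) ^ (-(d : ℝ) / 2) * c + 1, by positivity, fun r hr x y => ?_⟩
  have hR : 0 < √r := Real.sqrt_pos.2 hr
  have hpt : ∀ y', ENNReal.ofReal (heatKernel d r (x - y')) * ENNReal.ofReal (‖y - y'‖ ^ (-β)) ≤
      ENNReal.ofReal ((4 * π * r) ^ (-(d : ℝ) / 2)) *
        (Metric.ball (0 : Ed d) √r).indicator (fun z => ENNReal.ofReal (‖z‖ ^ (-β))) (y - y') +
      ENNReal.ofReal (heatKernel d r (x - y')) * ENNReal.ofReal (√r ^ (-β)) := by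
    intro y'
    by_cases hy : y - y' ∈ Metric.ball (0 : Ed d) √r
    · refine le_add_right ?_
      rw [indicator_of_mem hy]
      gcongr
      unfold heatKernel
      refine mul_le_of_le_one_right (by positivity) (Real.exp_le_one_iff.2 ?_)
      rw [neg_div, neg_nonpos]
      positivity
    · refine le_add_left ?_
      refine mul_le_mul' le_rfl (ENNReal.ofReal_le_ofReal ?_)
      exact Real.rpow_le_rpow_of_nonpos hR (by simpa using hy) (by linarith)
  refine (lintegral_mono hpt).trans ?_
  have m2 : Measurable (fun y' : Ed d => ENNReal.ofReal (heatKernel d r (x - y'))) := by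
    unfold heatKernel; fun_prop
  rw [lintegral_add_right _ (m2.mul_const _), lintegral_mul_const _ m2, sk_hk_int d hr,
    lintegral_const_mul' _ _ (by simp),
    lintegral_sub_left_eq_self (μ := (volume : Measure (Ed d))) ((Metric.ball (0 : Ed d) √r).indicator
      (fun z => ENNReal.ofReal (‖z‖ ^ (-β)))) y, lintegral_indicator measurableSet_ball, h _ hR,
    one_mul, ← ENNReal.ofReal_mul (by positivity), ← ENNReal.ofReal_add (by positivity) (by positivity)]
  apply le_of_eq
  congr 1
  rw [Real.sqrt_eq_rpow, ← Real.rpow_mul hr.le, ← Real.rpow_mul hr.le,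
    Real.mul_rpow (by positivity) hr.le]
  have e1 : (1 / 2 : ℝ) * ((d : ℝ) - β) = -(-(d : ℝ) / 2) + -β / 2 := by ring
  have e2 : (1 / 2 : ℝ) * -β = -β / 2 := by ring
  have e3 : r ^ (-(d : ℝ) / 2) * r ^ (-(-(d : ℝ) / 2)) = 1 := by
    rw [← Real.rpow_add hr]; simp
  rw [e1, e2, Real.rpow_add hr]
  linear_combination ((4 * π) ^ (-(d : ℝ) / 2) * c * r ^ (-β / 2)) * e3

lemma sk_hk_I {d : ℕ} (hd : 1 ≤ d) {β : ℝ} (hβ0 : 0 < β) (hβ : β < d) :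
    ∃ c : ℝ, 0 ≤ c ∧ ∀ r : ℝ, 0 ≤ r → ∀ x : Ed d,
      skI d β (fun y => ENNReal.ofReal (heatKernel d r (x - y)))
        (fun y => ENNReal.ofReal (heatKernel d r (x - y))) ≤ ENNReal.ofReal (c * r ^ (-β / 2)) := by
  obtain ⟨c, hc, h⟩ := sk_hk_riesz hd hβ0 hβ
  refine ⟨c, hc, fun r hr x => ?_⟩
  rcases hr.eq_or_lt with rfl | hr
  · simp [skI, sk_hk_zero hd]
  have m2 : Measurable (fun y' : Ed d => ENNReal.ofReal (heatKernel d r (x - y'))) := by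
    unfold heatKernel; fun_prop
  unfold skI
  calc _ ≤ ∫⁻ y, ENNReal.ofReal (heatKernel d r (x - y)) * ENNReal.ofReal (c * r ^ (-β / 2)) := by
        refine lintegral_mono fun y => ?_
        simp_rw [mul_assoc]
        rw [lintegral_const_mul' _ _ (by simp)]
        gcongr
        exact h r hr x y
    _ = _ := by rw [lintegral_mul_const _ m2, sk_hk_int d hr, one_mul]

lemma sk_time {β l t : ℝ} (hβ : β < 2) (hl : 0 < l) :
    ∫⁻ s in Ioc 0 t, ENNReal.ofReal (Real.exp (2 * l * s) * (t - s) ^ (-β / 2)) ≤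
      ENNReal.ofReal (Real.exp (2 * l * t) *
        ((1 / (2 * l)) ^ (1 - β / 2) * Real.Gamma (1 - β / 2))) := by
  have ha : 0 < 1 - β / 2 := by linarith
  set F : ℝ → ℝ≥0∞ := (Ioi (0 : ℝ)).indicator fun u =>
    ENNReal.ofReal (u ^ (1 - β / 2 - 1) * Real.exp (-(2 * l * u))) with hF
  calc _ ≤ ∫⁻ s in Ioc 0 t, ENNReal.ofReal (Real.exp (2 * l * t)) * F (t - s) := by
        apply lintegral_mono_ae
        have hne : ∀ᵐ s ∂(volume.restrict (Ioc 0 t)), s ≠ t :=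
          ae_restrict_of_ae (Measure.ae_ne volume t)
        filter_upwards [hne, ae_restrict_mem measurableSet_Ioc] with s hs hs'
        have hpos : t - s ∈ Ioi (0 : ℝ) := sub_pos.2 (lt_of_le_of_ne hs'.2 hs)
        rw [hF, indicator_of_mem hpos, ← ENNReal.ofReal_mul (by positivity)]
        apply le_of_eq; congr 1
        have : Real.exp (2 * l * s) = Real.exp (2 * l * t) * Real.exp (-(2 * l * (t - s))) := by
          rw [← Real.exp_add]; ring_nf
        rw [this]
        have : 1 - β / 2 - 1 = -β / 2 := by ring
        rw [this]; ring
    _ ≤ ∫⁻ s, ENNReal.ofReal (Real.exp (2 * l * t)) * F (t - s) :=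
        lintegral_mono' Measure.restrict_le_self le_rfl
    _ = _ := by
        rw [lintegral_const_mul' _ _ (by simp),
          lintegral_sub_left_eq_self (μ := (volume : Measure ℝ)) F t, hF,
          lintegral_indicator measurableSet_Ioi, sk_gamma ha (by positivity),
          ← ENNReal.ofReal_mul (by positivity)]

lemma sk_main_bound {d : ℕ} (hd : 1 ≤ d) {β : ℝ} (hβ0 : 0 < β) (hβ : β < d) (hβ2 : β < 2) (T : ℝ) :
    ∃ c : ℝ, 0 ≤ c ∧ ∀ l : ℝ, 0 < l → ∀ m : ℝ, 0 ≤ m → ∀ t ∈ Icc 0 T, ∀ x : Ed d,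
      ∀ f : ℝ → Ed d → ℝ, skM f →
      (∀ s ∈ Ioc 0 t, ∀ y, |f s y| ≤ m * Real.exp (l * s) * heatKernel d (t - s) (x - y)) →
      (∀ s, t < s → ∀ y, f s y = 0) →
      Integrable (skq d β f f) (skP d T) ∧
      skB d β T f f ≤ m ^ 2 * Real.exp (2 * l * t) * (c * (1 / (2 * l)) ^ (1 - β / 2)) := by
  obtain ⟨c, hc, h⟩ := sk_hk_I hd hβ0 hβ
  have hG : 0 < Real.Gamma (1 - β / 2) := Real.Gamma_pos_of_pos (by linarith)
  refine ⟨c * Real.Gamma (1 - β / 2), by positivity, fun l hl m hm t ht x f hf hf1 hf2 => ?_⟩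
  have key : ∫⁻ p, ‖skq d β f f p‖ₑ ∂(skP d T) ≤ ENNReal.ofReal (m ^ 2 * Real.exp (2 * l * t) *
      (c * Real.Gamma (1 - β / 2) * (1 / (2 * l)) ^ (1 - β / 2))) := by
    rw [skq_lint β T hf hf]
    calc _ ≤ ∫⁻ s in Ioc 0 T, (Ioc 0 t).indicator (fun s => ENNReal.ofReal (m ^ 2 * c) *
            ENNReal.ofReal (Real.exp (2 * l * s) * (t - s) ^ (-β / 2))) s := by
          apply lintegral_mono_ae
          filter_upwards [ae_restrict_mem measurableSet_Ioc] with s hs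
          by_cases hst : s ∈ Ioc 0 t
          · rw [indicator_of_mem hst]
            have hr : 0 ≤ t - s := sub_nonneg.2 hst.2
            have hb : ∀ y, ‖f s y‖ₑ ≤ ENNReal.ofReal (m * Real.exp (l * s)) *
                ENNReal.ofReal (heatKernel d (t - s) (x - y)) := fun y => by
              rw [← ofReal_norm, ← ENNReal.ofReal_mul (by positivity)]
              exact ENNReal.ofReal_le_ofReal (hf1 s hst y)
            calc _ ≤ (ENNReal.ofReal (m * Real.exp (l * s)) * ENNReal.ofReal (m * Real.exp (l * s))) *
                  skI d β (fun y => ENNReal.ofReal (heatKernel d (t - s) (x - y)))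
                    (fun y => ENNReal.ofReal (heatKernel d (t - s) (x - y))) := by
                  unfold skI
                  rw [← lintegral_const_mul' _ _ (ENNReal.mul_ne_top (by simp) (by simp))]
                  refine lintegral_mono fun y => ?_
                  rw [← lintegral_const_mul' _ _ (ENNReal.mul_ne_top (by simp) (by simp))]
                  refine lintegral_mono fun y' => ?_
                  refine (mul_le_mul_left (mul_le_mul' (hb y) (hb y')) _).trans_eq ?_
                  ring
              _ ≤ _ := by
                  refine (mul_le_mul_right (h _ hr x) _).trans_eq ?_
                  rw [← ENNReal.ofReal_mul (by positivity), ← ENNReal.ofReal_mul (by positivity),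
                    ← ENNReal.ofReal_mul (by positivity)]
                  congr 1
                  have : Real.exp (2 * l * s) = Real.exp (l * s) * Real.exp (l * s) := by
                    rw [← Real.exp_add]; ring_nf
                  rw [this]; ring
          · have : t < s := by
              by_contra hcon
              exact hst ⟨hs.1, not_lt.1 hcon⟩
            simp [skI, hf2 s this]
      _ ≤ ∫⁻ s, (Ioc 0 t).indicator (fun s => ENNReal.ofReal (m ^ 2 * c) *
            ENNReal.ofReal (Real.exp (2 * l * s) * (t - s) ^ (-β / 2))) s :=
          lintegral_mono' Measure.restrict_le_self le_rfl
      _ ≤ _ := by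
          rw [lintegral_indicator measurableSet_Ioc, lintegral_const_mul' _ _ (by simp)]
          refine (mul_le_mul_right (sk_time hβ2 hl) _).trans_eq ?_
          rw [← ENNReal.ofReal_mul (by positivity)]
          congr 1; ring
  refine ⟨⟨(skq_meas β hf hf).aestronglyMeasurable, key.trans_lt (by simp)⟩, ?_⟩
  have h1 := (enorm_integral_le_lintegral_enorm (μ := skP d T) (skq d β f f)).trans key
  rw [← ofReal_norm] at h1
  exact (le_abs_self _).trans ((ENNReal.ofReal_le_ofReal_iff (by positivity)).1 h1)

/-- cut-off heat kernel weight -/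
def skf (d : ℕ) (t : ℝ) (x : Ed d) (Ψ : ℝ → Ed d → ℝ) (s : ℝ) (y : Ed d) : ℝ :=
  (Iic t).indicator (fun s => heatKernel d (t - s) (x - y) * Ψ s y) s

lemma skf_meas {d : ℕ} (t : ℝ) (x : Ed d) {Ψ : ℝ → Ed d → ℝ} (hΨ : skM Ψ) :
    skM (skf d t x Ψ) := by
  have h1 : Measurable (fun p : ℝ × Ed d => heatKernel d (t - p.1) (x - p.2) * Ψ p.1 p.2) :=
    Measurable.mul (sk_hk_meas' d t x) hΨ
  have h2 := h1.indicator (measurable_fst (measurableSet_Iic (a := t)))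
  exact h2

lemma sk_noise {d : ℕ} {β T t : ℝ} (ht : t ≤ T) (x : Ed d) {Ψ k : ℝ → Ed d → ℝ}
    (hi : Integrable (skq d β (skf d t x Ψ) k) (skP d T)) :
    ∫ s in Ioc (0 : ℝ) t, ∫ y : Ed d, ∫ y' : Ed d,
          heatKernel d (t - s) (x - y) * Ψ s y * ‖y - y'‖ ^ (-β) * k s y' =
      skB d β T (skf d t x Ψ) k := by
  rw [skB_iter hi]
  rw [setIntegral_eq_of_subset_of_forall_sdiff_eq_zero (s := Ioc 0 t) (t := Ioc 0 T)
    measurableSet_Ioc (Ioc_subset_Ioc_right ht)]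
  · refine setIntegral_congr_fun measurableSet_Ioc fun s hs => ?_
    simp only [skf, indicator_of_mem (mem_Iic.2 hs.2)]
    congr 1; ext y; congr 1; ext y'; ring
  · intro s hs
    have : s ∉ Iic t := fun h => hs.2 ⟨hs.1.1, h⟩
    simp [skf, indicator_of_notMem this]

lemma skf_bound {d : ℕ} {t l m : ℝ} {x : Ed d} {Ψ : ℝ → Ed d → ℝ}
    (hb : ∀ s ∈ Ioc 0 t, ∀ y, |Ψ s y| ≤ m * Real.exp (l * s)) :
    ∀ s ∈ Ioc 0 t, ∀ y,
      |skf d t x Ψ s y| ≤ m * Real.exp (l * s) * heatKernel d (t - s) (x - y) := by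
  intro s hs y
  have h0 := sk_hk_nonneg d (sub_nonneg.2 hs.2) (x - y)
  rw [skf, indicator_of_mem (mem_Iic.2 hs.2), abs_mul, abs_of_nonneg h0, mul_comm]
  exact mul_le_mul_of_nonneg_right (hb s hs y) h0

lemma skf_zero {d : ℕ} {t : ℝ} {x : Ed d} {Ψ : ℝ → Ed d → ℝ} :
    ∀ s, t < s → ∀ y, skf d t x Ψ s y = 0 := by
  intro s hs y
  rw [skf, indicator_of_notMem (by simpa using hs)]

lemma sk_drift {d : ℕ} (hd : 1 ≤ d) {t l m : ℝ} (hl : 0 < l) (hm : 0 ≤ m) (x : Ed d)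
    {Ψ : ℝ → Ed d → ℝ} (hΨ : skM Ψ) (hb : ∀ s ∈ Ioc 0 t, ∀ y, |Ψ s y| ≤ m * Real.exp (l * s)) :
    Integrable (fun p : ℝ × Ed d => heatKernel d (t - p.1) (x - p.2) * Ψ p.1 p.2)
      ((volume.restrict (Ioc 0 t)).prod volume) ∧
    |∫ p, heatKernel d (t - p.1) (x - p.2) * Ψ p.1 p.2 ∂((volume.restrict (Ioc 0 t)).prod volume)|
      ≤ m / l * Real.exp (l * t) := by
  have h1 : Measurable (fun p : ℝ × Ed d => heatKernel d (t - p.1) (x - p.2) * Ψ p.1 p.2) :=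
    Measurable.mul (sk_hk_meas' d t x) hΨ
  have key : ∫⁻ p, ‖heatKernel d (t - p.1) (x - p.2) * Ψ p.1 p.2‖ₑ
      ∂((volume.restrict (Ioc 0 t)).prod volume) ≤ ENNReal.ofReal (m / l * Real.exp (l * t)) := by
    rw [lintegral_prod _ h1.enorm.aemeasurable]
    calc _ ≤ ∫⁻ s in Ioc 0 t, ENNReal.ofReal m *
          ENNReal.ofReal (Real.exp (2 * (l / 2) * s) * (t - s) ^ (-0 / 2 : ℝ)) := by
          apply lintegral_mono_ae
          filter_upwards [ae_restrict_mem measurableSet_Ioc] with s hs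
          have hr : 0 ≤ t - s := sub_nonneg.2 hs.2
          have e : Real.exp (2 * (l / 2) * s) * (t - s) ^ (-0 / 2 : ℝ) = Real.exp (l * s) := by
            rw [neg_zero, zero_div, Real.rpow_zero, mul_one]; ring_nf
          rw [e]
          rcases hr.eq_or_lt with hr | hr
          · simp [← hr, sk_hk_zero hd]
          calc _ ≤ ∫⁻ y, ENNReal.ofReal (m * Real.exp (l * s)) *
                ENNReal.ofReal (heatKernel d (t - s) (x - y)) := by
                refine lintegral_mono fun y => ?_
                have h0 := sk_hk_nonneg d hr.le (x - y)
                rw [← ofReal_norm, ← ENNReal.ofReal_mul (by positivity), norm_mul,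
                  Real.norm_of_nonneg h0, mul_comm]
                exact ENNReal.ofReal_le_ofReal (mul_le_mul_of_nonneg_right (hb s hs y) h0)
            _ = _ := by
                rw [lintegral_const_mul' _ _ (by simp), sk_hk_int d hr, mul_one,
                  ENNReal.ofReal_mul hm]
      _ ≤ _ := by
          rw [lintegral_const_mul' _ _ (by simp)]
          refine (mul_le_mul_right (sk_time (by norm_num) (half_pos hl)) _).trans_eq ?_
          rw [← ENNReal.ofReal_mul hm]
          congr 1
          have : 2 * (l / 2) = l := by ring
          rw [this]
          simp
          field_simp
  refine ⟨⟨h1.aestronglyMeasurable, key.trans_lt (by simp)⟩, ?_⟩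
  have h2 := (enorm_integral_le_lintegral_enorm (μ := (volume.restrict (Ioc 0 t)).prod volume)
    (fun p : ℝ × Ed d => heatKernel d (t - p.1) (x - p.2) * Ψ p.1 p.2)).trans key
  rw [← ofReal_norm] at h2
  exact (ENNReal.ofReal_le_ofReal_iff (by positivity)).1 h2

lemma sk_choose (L Lb K c a : ℝ) (ha : 0 < a) : ∃ l : ℝ, 0 < l ∧
    L * √(K * (c * (1 / (2 * l)) ^ a)) ≤ 1 / 4 ∧ Lb / l ≤ 1 / 4 := by
  have t1 : Filter.Tendsto (fun l : ℝ => 1 / (2 * l)) Filter.atTop (nhds 0) :=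
    (Filter.tendsto_id.const_mul_atTop (two_pos)).const_div_atTop 1
  have t2 : Filter.Tendsto (fun l : ℝ => (1 / (2 * l)) ^ a) Filter.atTop (nhds 0) := by
    have := (Real.continuousAt_rpow_const 0 a (Or.inr ha.le)).tendsto.comp t1
    rwa [Real.zero_rpow ha.ne'] at this
  have t3 : Filter.Tendsto (fun l : ℝ => L * √(K * (c * (1 / (2 * l)) ^ a))) Filter.atTop (nhds 0) := by
    have := ((t2.const_mul c).const_mul K).sqrt.const_mul L
    simpa using this
  have t4 : Filter.Tendsto (fun l : ℝ => Lb / l) Filter.atTop (nhds 0) :=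
    Filter.tendsto_id.const_div_atTop Lb
  obtain ⟨l, h1, h2, h3⟩ := ((Filter.eventually_gt_atTop (0 : ℝ)).and
    ((t3.eventually (ge_mem_nhds (by norm_num : (0 : ℝ) < 1 / 4))).and
      (t4.eventually (ge_mem_nhds (by norm_num : (0 : ℝ) < 1 / 4))))).exists
  exact ⟨l, h1, h2, h3⟩

lemma sk_cs_abs {d : ℕ} (hd : 1 ≤ d) {β : ℝ} (hβ : 0 < β) {T : ℝ} {f g : ℝ → Ed d → ℝ}
    (hf : skM f) (hg : skM g) (hff : Integrable (skq d β f f) (skP d T))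
    (hgg : Integrable (skq d β g g) (skP d T)) {m E G K : ℝ} (hm : 0 ≤ m) (hE : 0 ≤ E)
    (hG : 0 ≤ G) (hK : 0 ≤ K)
    (h1 : skB d β T f f ≤ m ^ 2 * E ^ 2 * G) (h2 : skB d β T g g ≤ K) :
    |skB d β T f g| ≤ m * E * √(K * G) := by
  apply abs_le_of_sq_le_sq _ (by positivity)
  calc skB d β T f g ^ 2 ≤ skB d β T f f * skB d β T g g := skB_cs hd hβ hf hg hff hgg
    _ ≤ (m ^ 2 * E ^ 2 * G) * K :=
      mul_le_mul h1 h2 (skB_nonneg hd hβ hg hgg) (by positivity)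
    _ = _ := by rw [mul_pow, Real.sq_sqrt (by positivity)]; ring

lemma sk_core (d : ℕ) (hd : 1 ≤ d)
    (β T : ℝ) (hβ0 : 0 < β) (hβ : β < min (d : ℝ) 2) (hT : 0 < T)
    (σ b : ℝ → ℝ) (hσ : ∃ L : NNReal, LipschitzWith L σ) (hb : ∃ L : NNReal, LipschitzWith L b)
    (w : ℝ → Ed d → ℝ)
    (h : ℝ → Ed d → ℝ) (hh : Admissible d β T h) (M : ℝ) :
    ∃ C : ℝ, ∀ h₀ : ℝ → Ed d → ℝ, Admissible d β T h₀ → Hnorm d β T h₀ ≤ 1 →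
      ∀ Φ Φ' : ℝ → Ed d → ℝ,
        IsSkeletonSolution d β T σ b w (fun s y => h s y + h₀ s y) Φ →
        IsSkeletonSolution d β T σ b w h Φ' →
        (∀ t ∈ Icc (0 : ℝ) T, ∀ x : Ed d, |Φ' t x| ≤ M) →
        ∀ t ∈ Icc (0 : ℝ) T, ∀ x : Ed d,
          |Φ t x - Φ' t x| ≤ C * Hnorm d β T h₀ := by
  obtain ⟨L, hL⟩ := hσ
  obtain ⟨Lb, hLb⟩ := hb
  have hβd : β < d := hβ.trans_le (min_le_left _ _)
  have hβ2 : β < 2 := hβ.trans_le (min_le_right _ _)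
  obtain ⟨mh, ih, -, -⟩ := sk_adm hh
  have Bh := skB_nonneg hd hβ0 mh ih
  obtain ⟨c, hc, hmain⟩ := sk_main_bound hd hβ0 hβd hβ2 T
  set K : ℝ := 2 * skB d β T h h + 2 with hK
  have hK0 : 0 ≤ K := by positivity
  obtain ⟨l, hl, hl1, hl2⟩ := sk_choose L Lb K c (1 - β / 2) (by linarith)
  set G : ℝ := c * (1 / (2 * l)) ^ (1 - β / 2) with hG
  have hG0 : 0 ≤ G := by positivity
  have hLip : ∀ u v, |σ u - σ v| ≤ L * |u - v| := fun u v => by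
    simpa [Real.dist_eq] using hL.dist_le_mul u v
  have hLipb : ∀ u v, |b u - b v| ≤ Lb * |u - v| := fun u v => by
    simpa [Real.dist_eq] using hLb.dist_le_mul u v
  -- any bounded measurable function composed with σ, b
  have hlin : ∀ (τ : ℝ → ℝ) (Q : NNReal) (R u : ℝ), (∀ u v, |τ u - τ v| ≤ Q * |u - v|) → |u| ≤ R →
      |τ u| ≤ |τ 0| + Q * |R| := by
    intro τ Q R u hτ hu
    have h1 := hτ u 0
    have h2 : |τ u| ≤ |τ u - τ 0| + |τ 0| := by
      have := abs_add_le (τ u - τ 0) (τ 0)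
      simpa using this
    have h3 : (Q : ℝ) * |u - 0| ≤ Q * |R| :=
      mul_le_mul_of_nonneg_left (by rw [sub_zero]; exact hu.trans (le_abs_self R)) Q.2
    linarith
  set S : ℝ := |σ 0| + L * |M| with hS
  have hS0 : 0 ≤ S := by positivity
  refine ⟨2 * (S * √G) * Real.exp (l * T), ?_⟩
  intro h₀ hh₀ hH1 Φ Φ' hΦ hΦ' hM
  obtain ⟨mh0, ih0, hH0, hHe⟩ := sk_adm hh₀
  have Bh0 := skB_nonneg hd hβ0 mh0 ih0
  have hHsq := hHe Bh0
  set H := Hnorm d β T h₀ with hHdef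
  -- k = h + h₀
  have hk := skq_lin hd hβ0 mh mh0 ih ih0 1
  have hk' := skq_lin hd hβ0 mh mh0 ih ih0 (-1)
  simp only [one_mul] at hk
  obtain ⟨mk, ik, ek⟩ := hk
  have Bk : skB d β T (fun s y => h s y + h₀ s y) (fun s y => h s y + h₀ s y) ≤ K := by
    have := skB_nonneg hd hβ0 hk'.1 hk'.2.1
    rw [hk'.2.2] at this
    rw [ek, hK]
    nlinarith
  obtain ⟨MΦ, hMΦ⟩ := hΦ.bounded
  have mΦ : skM Φ := hΦ.measurable
  have mΦ' : skM Φ' := hΦ'.measurable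
  have mσΦ : skM (fun s y => σ (Φ s y)) := hL.continuous.measurable.comp mΦ
  have mσΦ' : skM (fun s y => σ (Φ' s y)) := hL.continuous.measurable.comp mΦ'
  have mbΦ : skM (fun s y => b (Φ s y)) := hLb.continuous.measurable.comp mΦ
  have mbΦ' : skM (fun s y => b (Φ' s y)) := hLb.continuous.measurable.comp mΦ'
  have mσd : skM (fun s y => σ (Φ s y) - σ (Φ' s y)) := Measurable.sub mσΦ mσΦ'
  have mbd : skM (fun s y => b (Φ s y) - b (Φ' s y)) := Measurable.sub mbΦ mbΦ'
  have step : ∀ N : ℝ, 0 ≤ N →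
      (∀ t ∈ Icc (0 : ℝ) T, ∀ x, |Φ t x - Φ' t x| ≤ N * Real.exp (l * t)) →
      ∀ t ∈ Icc (0 : ℝ) T, ∀ x, |Φ t x - Φ' t x| ≤ (N / 2 + S * √G * H) * Real.exp (l * t) := by
    intro N hN hNb t ht x
    have hmem : ∀ s ∈ Ioc 0 t, s ∈ Icc (0 : ℝ) T := fun s hs => ⟨hs.1.le, hs.2.trans ht.2⟩
    have hexp1 : ∀ s ∈ Ioc 0 t, (1 : ℝ) ≤ Real.exp (l * s) := fun s hs =>
      Real.one_le_exp (by have := hs.1; positivity)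
    have hup : ∀ R : ℝ, 0 ≤ R → ∀ s ∈ Ioc 0 t, R ≤ R * Real.exp (l * s) := fun R hR s hs =>
      le_mul_of_one_le_right hR (hexp1 s hs)
    -- bounds
    have b1 : ∀ s ∈ Ioc 0 t, ∀ y, |σ (Φ s y)| ≤ (|σ 0| + L * |MΦ|) * Real.exp (l * s) :=
      fun s hs y => (hlin σ L MΦ _ hLip (hMΦ s (hmem s hs) y)).trans (hup _ (by positivity) s hs)
    have b2 : ∀ s ∈ Ioc 0 t, ∀ y, |σ (Φ' s y)| ≤ S * Real.exp (l * s) :=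
      fun s hs y => (hlin σ L M _ hLip (hM s (hmem s hs) y)).trans (hup _ (by positivity) s hs)
    have b3 : ∀ s ∈ Ioc 0 t, ∀ y, |σ (Φ s y) - σ (Φ' s y)| ≤ (L * N) * Real.exp (l * s) :=
      fun s hs y => (hLip _ _).trans (by
        rw [mul_assoc]; exact mul_le_mul_of_nonneg_left (hNb s (hmem s hs) y) L.2)
    have b4 : ∀ s ∈ Ioc 0 t, ∀ y, |b (Φ s y)| ≤ (|b 0| + Lb * |MΦ|) * Real.exp (l * s) :=
      fun s hs y => (hlin b Lb MΦ _ hLipb (hMΦ s (hmem s hs) y)).trans (hup _ (by positivity) s hs)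
    have b5 : ∀ s ∈ Ioc 0 t, ∀ y, |b (Φ' s y)| ≤ (|b 0| + Lb * |M|) * Real.exp (l * s) :=
      fun s hs y => (hlin b Lb M _ hLipb (hM s (hmem s hs) y)).trans (hup _ (by positivity) s hs)
    have b6 : ∀ s ∈ Ioc 0 t, ∀ y, |b (Φ s y) - b (Φ' s y)| ≤ (Lb * N) * Real.exp (l * s) :=
      fun s hs y => (hLipb _ _).trans (by
        rw [mul_assoc]; exact mul_le_mul_of_nonneg_left (hNb s (hmem s hs) y) Lb.2)
    have m1 := skf_meas t x mσΦ
    have m2 := skf_meas t x mσΦ'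
    have m3 := skf_meas t x mσd
    have n1 := hmain l hl _ (by positivity) t ht x _ m1 (skf_bound b1) skf_zero
    have n2 := hmain l hl _ hS0 t ht x _ m2 (skf_bound b2) skf_zero
    have n3 := hmain l hl _ (by positivity) t ht x _ m3 (skf_bound b3) skf_zero
    have i1k := skq_int hd hβ0 m1 mk n1.1 ik
    have i2h := skq_int hd hβ0 m2 mh n2.1 ih
    have i2h0 := skq_int hd hβ0 m2 mh0 n2.1 ih0
    have i3k := skq_int hd hβ0 m3 mk n3.1 ik
    have hsplit : skB d β T (skf d t x fun s y => σ (Φ s y)) (fun s y => h s y + h₀ s y) =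
        skB d β T (skf d t x fun s y => σ (Φ s y) - σ (Φ' s y)) (fun s y => h s y + h₀ s y) +
        (skB d β T (skf d t x fun s y => σ (Φ' s y)) h +
          skB d β T (skf d t x fun s y => σ (Φ' s y)) h₀) := by
      unfold skB
      rw [← integral_add i2h i2h0]
      refine Eq.trans ?_ (integral_add i3k (i2h.add i2h0))
      congr 1; ext p
      simp only [skq, skf]
      by_cases hp : p.1 ∈ Iic t
      · simp only [indicator_of_mem hp]; ring
      · simp only [indicator_of_notMem hp]; ring
    have d1 := sk_drift hd hl (by positivity) x mbΦ b4
    have d2 := sk_drift hd hl (by positivity) x mbΦ' b5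
    have d3 := sk_drift hd hl (by positivity) x mbd b6
    have eqΦ := hΦ.eqn t ht x
    have eqΦ' := hΦ'.eqn t ht x
    rw [sk_noise ht.2 x (Ψ := fun s y => σ (Φ s y)) i1k, ← integral_prod _ d1.1] at eqΦ
    rw [sk_noise ht.2 x (Ψ := fun s y => σ (Φ' s y)) i2h, ← integral_prod _ d2.1] at eqΦ'
    have dd := integral_sub d1.1 d2.1
    simp_rw [← mul_sub] at dd
    have hE : Real.exp (2 * l * t) = Real.exp (l * t) ^ 2 := by
      rw [← Real.exp_nat_mul]; push_cast; ring_nf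
    rw [hE] at n2 n3
    have c1 := sk_cs_abs hd hβ0 m3 mk n3.1 ik (by positivity) (Real.exp_pos _).le hG0 hK0 n3.2 Bk
    have c2 := sk_cs_abs hd hβ0 m2 mh0 n2.1 ih0 hS0 (Real.exp_pos _).le hG0 (sq_nonneg H) n2.2
      hHsq.ge
    rw [Real.sqrt_mul (sq_nonneg H), Real.sqrt_sq hH0] at c2
    have c3 := d3.2
    rw [dd] at c3
    have c1' : (L * N) * Real.exp (l * t) * √(K * G) ≤ 1 / 4 * (N * Real.exp (l * t)) := by
      have := mul_le_mul_of_nonneg_right hl1 (show 0 ≤ N * Real.exp (l * t) by positivity)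
      linarith
    have c3' : (Lb * N) / l * Real.exp (l * t) ≤ 1 / 4 * (N * Real.exp (l * t)) := by
      have := mul_le_mul_of_nonneg_right hl2 (show 0 ≤ N * Real.exp (l * t) by positivity)
      calc _ = (Lb / l) * (N * Real.exp (l * t)) := by ring
        _ ≤ _ := this
    rw [eqΦ, eqΦ', hsplit]
    rw [abs_le] at c1 c2 c3 ⊢
    constructor <;> linarith [c1.1, c1.2, c2.1, c2.2, c3.1, c3.2]
  have hSG : 0 ≤ S * √G * H := by positivity
  have iter : ∀ n : ℕ, ∀ t ∈ Icc (0 : ℝ) T, ∀ x, |Φ t x - Φ' t x| ≤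
      ((|MΦ| + |M|) * (1 / 2) ^ n + 2 * (S * √G * H)) * Real.exp (l * t) := by
    intro n
    induction n with
    | zero =>
      intro t ht x
      have h1 := hMΦ t ht x
      have h2 := hM t ht x
      have h3 : (1 : ℝ) ≤ Real.exp (l * t) := Real.one_le_exp (by have := ht.1; positivity)
      have h4 := abs_sub (Φ t x) (Φ' t x)
      have h5 : |Φ t x - Φ' t x| ≤ |MΦ| + |M| := by
        linarith [le_abs_self MΦ, le_abs_self M]
      refine h5.trans (le_trans ?_ (le_mul_of_one_le_right (by positivity) h3))
      simp; positivity
    | succ n ih =>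
      intro t ht x
      refine (step _ (by positivity) ih t ht x).trans_eq ?_
      rw [pow_succ]; ring
  intro t ht x
  have hlim : Filter.Tendsto (fun n : ℕ => ((|MΦ| + |M|) * (1 / 2) ^ n + 2 * (S * √G * H)) *
      Real.exp (l * t)) Filter.atTop (nhds (((|MΦ| + |M|) * 0 + 2 * (S * √G * H)) * Real.exp (l * t))) :=
    (((tendsto_pow_atTop_nhds_zero_of_lt_one (by norm_num) (by norm_num)).const_mul _).add_const
      _).mul_const _
  have hfin := ge_of_tendsto' hlim (fun n => iter n t ht x)
  refine hfin.trans ?_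
  have h6 : Real.exp (l * t) ≤ Real.exp (l * T) :=
    Real.exp_le_exp.2 (mul_le_mul_of_nonneg_left ht.2 hl.le)
  calc _ = 2 * (S * √G * H) * Real.exp (l * t) := by ring
    _ ≤ 2 * (S * √G * H) * Real.exp (l * T) := by gcongr
    _ = _ := by ring

/-- For a fixed admissible `h` there is a constant `C` such that for every admissible `h₀`
with `H(h₀) ≤ 1`,
`sup_{(t,x)∈[0,T]×ℝ^d} |Φ^{h+h₀}(t,x) − Φ^h(t,x)| ≤ C · H(h₀)`; in particular the map
`h ↦ Φ^h(t,x)` is continuous at each admissible `h`. -/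
theorem skeleton_solution_lipschitz_in_h (d : ℕ) (hd : 1 ≤ d)
    (β T : ℝ) (hβ0 : 0 < β) (hβ : β < min (d : ℝ) 2) (hT : 0 < T)
    (σ b : ℝ → ℝ) (hσ : ∃ L : NNReal, LipschitzWith L σ) (hb : ∃ L : NNReal, LipschitzWith L b)
    (w : ℝ → Ed d → ℝ)
    (hwcont : ContinuousOn (fun p : ℝ × Ed d => w p.1 p.2) (Icc (0 : ℝ) T ×ˢ univ))
    (hwbdd : ∃ M : ℝ, ∀ t ∈ Icc (0 : ℝ) T, ∀ x : Ed d, |w t x| ≤ M)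
    (h : ℝ → Ed d → ℝ) (hh : Admissible d β T h) :
    ∃ C : ℝ, ∀ h₀ : ℝ → Ed d → ℝ, Admissible d β T h₀ → Hnorm d β T h₀ ≤ 1 →
      ∀ Φ Φ' : ℝ → Ed d → ℝ,
        IsSkeletonSolution d β T σ b w (fun s y => h s y + h₀ s y) Φ →
        IsSkeletonSolution d β T σ b w h Φ' →
        ∀ t ∈ Icc (0 : ℝ) T, ∀ x : Ed d,
          |Φ t x - Φ' t x| ≤ C * Hnorm d β T h₀ := by
  by_cases hex : ∃ Ψ, IsSkeletonSolution d β T σ b w h Ψ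
  · obtain ⟨Ψ, hΨ⟩ := hex
    obtain ⟨M, hM⟩ := hΨ.bounded
    obtain ⟨C, hC⟩ := sk_core d hd β T hβ0 hβ hT σ b hσ hb w h hh M
    refine ⟨C, fun h₀ hh₀ hH Φ Φ' hΦ hΦ' => hC h₀ hh₀ hH Φ Φ' hΦ hΦ' ?_⟩
    intro t ht x
    have hz : Admissible d β T (fun _ _ => 0) := ⟨measurable_const, by simp⟩
    have hz0 : Hnorm d β T (fun _ _ => 0) = 0 := by simp [Hnorm]
    have h1 := hC (fun _ _ => 0) hz (by rw [hz0]; norm_num) Φ' Ψ (by simpa using hΦ') hΨ hM t ht x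
    rw [hz0, mul_zero] at h1
    have h2 : Φ' t x = Ψ t x := sub_eq_zero.1 (abs_nonpos_iff.1 h1)
    rw [h2]
    exact hM t ht x
  · exact ⟨0, fun h₀ _ _ Φ Φ' _ hΦ' => absurd ⟨Φ', hΦ'⟩ hex⟩

end
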